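/- arXiv:1807.04197 — 2 statements merged into one kernel-verified Lean document; each statement's English description precedes it below -/
import Mathlib

section
/- For any Young diagram ν, the sum over all Young diagrams λ obtained from ν by removing one corner box of the content of the removed box divided by the product of hook lengths of λ equals 2/H_ν times the sum of the contents of all boxes of ν, where H_ν is the product of hook lengths of ν. That is, ∑_{λ ∈ ν∖1} cr(□_{ν/λ})/H_λ = (2/H_ν) ∑_{□∈ν} cr(□). -/
open Finset

/-- The content of a box with (0-indexed) row `c.1` and column `c.2`. -/
def boxContent (c : ℕ × ℕ) : ℤ := (c.2 : ℤ) - (c.1 : ℤ)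

/-- The hook length of a box `c` in a diagram with set of boxes `s`:
arm length plus leg length plus one. -/
def hook (s : Finset (ℕ × ℕ)) (c : ℕ × ℕ) : ℕ :=
  (s.filter fun d => d.1 = c.1 ∧ c.2 < d.2).card +
  (s.filter fun d => d.2 = c.2 ∧ c.1 < d.1).card + 1

/-- The product of all hook lengths. -/
def Hprod (s : Finset (ℕ × ℕ)) : ℕ := ∏ c ∈ s, hook s c

/-- The removable corner boxes of a diagram with boxes `s`. -/
def corners (s : Finset (ℕ × ℕ)) : Finset (ℕ × ℕ) :=
  s.filter fun c => (c.1 + 1, c.2) ∉ s ∧ (c.1, c.2 + 1) ∉ s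

lemma aux_pf (x : ℕ → ℚ) (n : ℕ) : ∀ (y : ℚ), (∀ i < n, ∀ j < n, i ≠ j → x i ≠ x j) →
    (∀ j < n, y ≠ x j) →
    ∏ j ∈ range n, (1 - 1 / (y - x j)) =
    1 - ∑ i ∈ range n, (∏ j ∈ (range n).erase i, (1 - 1 / (x i - x j))) / (y - x i) := by
  induction n with
  | zero => intro y _ _; simp
  | succ n ih =>
    intro y hx hy
    have hx' : ∀ i < n, ∀ j < n, i ≠ j → x i ≠ x j := fun i hi j hj => hx i (by omega) j (by omega)
    have h1 := ih y hx' (fun j hj => hy j (by omega))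
    have h2 := ih (x n) hx' (fun j hj => hx n (by omega) j (by omega) (by omega))
    rw [prod_range_succ, sum_range_succ]
    have e1 : (range (n+1)).erase n = range n := by
      ext a; simp; omega
    have e2 : ∀ i ∈ range n,
        (∏ j ∈ (range (n+1)).erase i, (1 - 1 / (x i - x j))) / (y - x i) =
        (∏ j ∈ (range n).erase i, (1 - 1 / (x i - x j))) / (y - x i)
        + (1 / (y - x n)) * ((∏ j ∈ (range n).erase i, (1 - 1 / (x i - x j))) / (x n - x i))
        - (1 / (y - x n)) * ((∏ j ∈ (range n).erase i, (1 - 1 / (x i - x j))) / (y - x i)) := by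
      intro i hi
      have hi' := mem_range.1 hi
      have : (range (n+1)).erase i = insert n ((range n).erase i) := by
        ext a; simp; omega
      rw [this, prod_insert (by simp)]
      have a1 : y - x n ≠ 0 := sub_ne_zero.2 (hy n (by omega))
      have a2 : y - x i ≠ 0 := sub_ne_zero.2 (hy i (by omega))
      have a3 : x n - x i ≠ 0 := sub_ne_zero.2 (hx n (by omega) i (by omega) (by omega))
      have a4 : x i - x n ≠ 0 := sub_ne_zero.2 (hx i (by omega) n (by omega) (by omega))
      have a5 : x i - x n = - (x n - x i) := by ring
      rw [a5]
      field_simp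
      ring
    rw [sum_congr rfl e2, e1, sum_sub_distrib, sum_add_distrib, ← mul_sum, ← mul_sum, h2, h1]
    ring

lemma aux_F (x : ℕ → ℚ) (n : ℕ) (hx : ∀ i < n, ∀ j < n, i ≠ j → x i ≠ x j) :
    (∑ i ∈ range n, (∏ j ∈ (range n).erase i, (1 - 1 / (x i - x j))) = n) ∧
    (∑ i ∈ range n, x i * (∏ j ∈ (range n).erase i, (1 - 1 / (x i - x j)))
      = ∑ i ∈ range n, x i - n * (n - 1) / 2) ∧
    (∑ i ∈ range n, x i ^ 2 * (∏ j ∈ (range n).erase i, (1 - 1 / (x i - x j)))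
      = ∑ i ∈ range n, x i ^ 2 - (n - 1) * ∑ i ∈ range n, x i + n * (n - 1) * (n - 2) / 6) := by
  induction n with
  | zero => simp
  | succ n ih =>
    have hx' : ∀ i < n, ∀ j < n, i ≠ j → x i ≠ x j := fun i hi j hj => hx i (by omega) j (by omega)
    obtain ⟨h0, h1, h2⟩ := ih hx'
    have hp := aux_pf x n (x n) hx' (fun j hj => hx n (by omega) j (by omega) (by omega))
    have e1 : (range (n+1)).erase n = range n := by
      ext a; simp; omega
    set w : ℕ → ℚ := fun i => ∏ j ∈ (range n).erase i, (1 - 1 / (x i - x j)) with hw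
    have e2 : ∀ i ∈ range n, (∏ j ∈ (range (n+1)).erase i, (1 - 1 / (x i - x j))) =
        w i + w i / (x n - x i) := by
      intro i hi
      have hi' := mem_range.1 hi
      have : (range (n+1)).erase i = insert n ((range n).erase i) := by
        ext a; simp; omega
      have a5 : 1 / (x i - x n) = -(1 / (x n - x i)) := by rw [← neg_sub (x n) (x i), div_neg]
      rw [this, prod_insert (by simp), a5]
      change _ * w i = _
      ring
    have e3 : ∀ i ∈ range n, x i * (∏ j ∈ (range (n+1)).erase i, (1 - 1 / (x i - x j))) =
        x i * w i - w i + x n * (w i / (x n - x i)) := by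
      intro i hi
      have hi' := mem_range.1 hi
      have a3 : x n - x i ≠ 0 := sub_ne_zero.2 (hx n (by omega) i (by omega) (by omega))
      rw [e2 i hi]
      field_simp
      ring
    have e4 : ∀ i ∈ range n, x i ^ 2 * (∏ j ∈ (range (n+1)).erase i, (1 - 1 / (x i - x j))) =
        x i ^ 2 * w i - x i * w i - x n * w i + x n ^ 2 * (w i / (x n - x i)) := by
      intro i hi
      have hi' := mem_range.1 hi
      have a3 : x n - x i ≠ 0 := sub_ne_zero.2 (hx n (by omega) i (by omega) (by omega))
      rw [e2 i hi]
      field_simp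
      ring
    simp only [sum_range_succ _ n]
    rw [sum_congr rfl e2, sum_congr rfl e3, sum_congr rfl e4, e1, hp]
    simp only [sum_add_distrib, sum_sub_distrib, ← mul_sum]
    change ∑ i ∈ range n, w i = _ at h0
    change ∑ i ∈ range n, x i * w i = _ at h1
    change ∑ i ∈ range n, x i ^ 2 * w i = _ at h2
    change _ ∧ _ ∧ _
    rw [h0, h1, h2]
    push_cast
    refine ⟨?_, ?_, ?_⟩ <;> ring

lemma aux_poly (n : ℕ) (a : ℚ) (m : ℕ) :
    ∑ i ∈ range m, (a - 1 - i) * (a + i) = m * a * (a - 1) - (m : ℚ) * (m - 1) / 2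
      - (m : ℚ) * (m - 1) * (2 * m - 1) / 6 := by
  induction m with
  | zero => simp
  | succ m ih => rw [sum_range_succ, ih]; push_cast; ring

/-- Main rational identity. -/
lemma aux_main (r : ℕ → ℚ) (n : ℕ) (x : ℕ → ℚ) (hxr : ∀ i < n, x i = r i + (n - 1 - i))
    (hx : ∀ i < n, ∀ j < n, i ≠ j → x i ≠ x j) :
    ∑ i ∈ range n, (r i - 1 - i) * (x i * ∏ j ∈ (range n).erase i, (1 - 1 / (x i - x j)))
    = ∑ i ∈ range n, (r i ^ 2 - r i * (1 + 2 * i)) := by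
  obtain ⟨h0, h1, h2⟩ := aux_F x n hx
  have e : ∀ i ∈ range n,
      (r i - 1 - i) * (x i * ∏ j ∈ (range n).erase i, (1 - 1 / (x i - x j))) =
      x i ^ 2 * (∏ j ∈ (range n).erase i, (1 - 1 / (x i - x j)))
      - n * (x i * (∏ j ∈ (range n).erase i, (1 - 1 / (x i - x j)))) := by
    intro i hi
    have := hxr i (mem_range.1 hi)
    have h : r i = x i - (n - 1 - i) := by rw [this]; ring
    rw [h]; ring
  have e' : ∀ i ∈ range n, (r i ^ 2 - r i * (1 + 2 * i)) =
      x i ^ 2 - (2 * n - 1) * x i + ((n : ℚ) - 1 - i) * (n + i) := by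
    intro i hi
    have := hxr i (mem_range.1 hi)
    rw [this]; ring
  rw [sum_congr rfl e, sum_congr rfl e', sum_sub_distrib, ← mul_sum, h1, h2, sum_add_distrib,
    sum_sub_distrib, ← mul_sum, aux_poly n]
  ring

def DD (f : ℕ → ℚ) (n : ℕ) : ℚ := ∏ b ∈ range n, ∏ a ∈ range b, (f a - f b)

lemma DD_update (f g : ℕ → ℚ) (i : ℕ) (hfg : ∀ j, j ≠ i → g j = f j) (n : ℕ) (hi : i < n) :
    DD g n * ∏ j ∈ (range n).erase i, (f i - f j) =
    DD f n * ∏ j ∈ (range n).erase i, (g i - f j) := by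
  induction n with
  | zero => omega
  | succ n ih =>
    have hs : ∀ f, DD f (n+1) = DD f n * ∏ a ∈ range n, (f a - f n) := fun f => by
      rw [DD, prod_range_succ]; rfl
    rw [hs, hs]
    rcases Nat.lt_succ_iff_lt_or_eq.1 hi with h | h
    · have ih := ih h
      have : (range (n+1)).erase i = insert n ((range n).erase i) := by
        ext a; simp; omega
      rw [this, prod_insert (by simp), prod_insert (by simp)]
      rw [← mul_prod_erase (range n) (fun a => g a - g n) (mem_range.2 h),
        ← mul_prod_erase (range n) (fun a => f a - f n) (mem_range.2 h)]
      have : ∏ a ∈ (range n).erase i, (g a - g n) = ∏ a ∈ (range n).erase i, (f a - f n) := by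
        refine prod_congr rfl fun a ha => ?_
        rw [hfg a (mem_erase.1 ha).1, hfg n (by omega)]
      rw [this, hfg n (by omega)]
      linear_combination (g i - f n) * (f i - f n) * (∏ a ∈ (range n).erase i, (f a - f n)) * ih
    · subst h
      have e1 : (range (i+1)).erase i = range i := by
        ext a; simp; omega
      have e2 : DD g i = DD f i := by
        refine prod_congr rfl fun b hb => prod_congr rfl fun a ha => ?_
        have := mem_range.1 hb
        have := mem_range.1 ha
        rw [hfg a (by omega), hfg b (by omega)]
      rw [e1, e2]
      have e3 : ∏ a ∈ range i, (g a - g i) = ∏ a ∈ range i, (-1) * (g i - f a) := by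
        refine prod_congr rfl fun a ha => ?_
        have := mem_range.1 ha
        rw [hfg a (by omega)]; ring
      have e4 : ∏ a ∈ range i, (f a - f i) = ∏ a ∈ range i, (-1) * (f i - f a) := by
        refine prod_congr rfl fun a ha => ?_
        ring
      rw [e3, e4, prod_mul_distrib, prod_mul_distrib]
      ring

lemma DD_swap (f : ℕ → ℚ) (n : ℕ) : DD f n = ∏ i ∈ range n, ∏ j ∈ Ioo i n, (f i - f j) := by
  refine prod_comm' fun x y => ?_
  simp; omega

def LL (μ : YoungDiagram) (n i : ℕ) : ℕ := μ.rowLen i + (n - 1 - i)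

lemma hook_eq (μ : YoungDiagram) (i c : ℕ) (h : (i, c) ∈ μ) :
    hook μ.cells (i, c) = (μ.rowLen i - c - 1) + (μ.colLen c - i - 1) + 1 := by
  unfold hook
  have h1 : (μ.cells.filter fun d => d.1 = (i, c).1 ∧ (i, c).2 < d.2) =
      {i} ×ˢ Ioo c (μ.rowLen i) := by
    ext ⟨a, b⟩
    simp only [mem_filter, YoungDiagram.mem_cells, mem_product, mem_singleton, mem_Ioo,
      YoungDiagram.mem_iff_lt_rowLen]
    constructor
    · rintro ⟨hh, rfl, h2⟩; exact ⟨rfl, h2, hh⟩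
    · rintro ⟨rfl, h2, hh⟩; exact ⟨hh, rfl, h2⟩
  have h2 : (μ.cells.filter fun d => d.2 = (i, c).2 ∧ (i, c).1 < d.1) =
      Ioo i (μ.colLen c) ×ˢ {c} := by
    ext ⟨a, b⟩
    simp only [mem_filter, YoungDiagram.mem_cells, mem_product, mem_singleton, mem_Ioo,
      YoungDiagram.mem_iff_lt_colLen]
    constructor
    · rintro ⟨hh, rfl, h2⟩; exact ⟨⟨h2, hh⟩, rfl⟩
    · rintro ⟨⟨h2, hh⟩, rfl⟩; exact ⟨hh, rfl, h2⟩
  rw [h1, h2]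
  simp

lemma row_formula (μ : YoungDiagram) (n i : ℕ) (hi : i < n) (hn : ∀ j, n ≤ j → μ.rowLen j = 0) :
    (∏ c ∈ range (μ.rowLen i), hook μ.cells (i, c)) * ∏ j ∈ Ioo i n, (LL μ n i - LL μ n j) =
      (LL μ n i).factorial := by
  have key : ∀ a b, a < μ.colLen b ↔ b < μ.rowLen a := fun a b => by
    rw [← YoungDiagram.mem_iff_lt_colLen, YoungDiagram.mem_iff_lt_rowLen]
  have hcn : ∀ c, μ.colLen c ≤ n := by
    intro c
    by_contra h
    have := (key n c).1 (by omega)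
    rw [hn n le_rfl] at this
    omega
  set A : ℕ → ℕ := fun c => n + c - μ.colLen c with hA
  have hAinj : Set.InjOn A (range (μ.rowLen i)) := by
    have : StrictMono A := by
      intro a b hab
      have := μ.colLen_anti a b hab.le
      have := hcn a
      have := hcn b
      simp only [hA]; omega
    exact this.injective.injOn
  have hlt : ∀ a b, a < b → b < n → LL μ n b < LL μ n a := by
    intro a b hab hb
    have := μ.rowLen_anti a b hab.le
    unfold LL; omega
  have hLinj : Set.InjOn (LL μ n) (Ioo i n) := by
    intro a ha b hb hab
    simp only [coe_Ioo, Set.mem_Ioo] at ha hb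
    rcases lt_trichotomy a b with h | h | h
    · have := hlt a b h hb.2; omega
    · exact h
    · have := hlt b a h ha.2; omega
  have hdisj : Disjoint ((range (μ.rowLen i)).image A) ((Ioo i n).image (LL μ n)) := by
    rw [disjoint_left]
    rintro x hx hy
    obtain ⟨c, hc, rfl⟩ := mem_image.1 hx
    obtain ⟨j, hj, hjc⟩ := mem_image.1 hy
    rw [mem_range] at hc
    rw [mem_Ioo] at hj
    have := key j c
    have := hcn c
    simp only [hA, LL] at hjc
    omega
  have hAlt : ∀ c, c < μ.rowLen i → A c < LL μ n i := by
    intro c hc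
    have := (key i c).2 hc
    have := hcn c
    simp only [hA, LL]; omega
  have hun : (range (μ.rowLen i)).image A ∪ (Ioo i n).image (LL μ n) = range (LL μ n i) := by
    apply eq_of_subset_of_card_le
    · intro x hx
      rw [mem_range]
      rcases mem_union.1 hx with h | h
      · obtain ⟨c, hc, rfl⟩ := mem_image.1 h
        exact hAlt c (mem_range.1 hc)
      · obtain ⟨j, hj, rfl⟩ := mem_image.1 h
        rw [mem_Ioo] at hj
        exact hlt i j hj.1 hj.2
    · rw [card_union_of_disjoint hdisj, card_image_of_injOn hAinj, card_image_of_injOn hLinj]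
      simp only [card_range, Nat.card_Ioo, LL]
      omega
  rw [← Nat.descFactorial_self, Nat.descFactorial_eq_prod_range, ← hun, prod_union hdisj,
    prod_image hAinj, prod_image hLinj]
  congr 1
  refine prod_congr rfl fun c hc => ?_
  have hc := mem_range.1 hc
  have h1 := (key i c).2 hc
  rw [hook_eq μ i c (YoungDiagram.mem_iff_lt_rowLen.2 hc)]
  have := hcn c
  simp only [hA, LL]
  omega

lemma cells_sigma {M : Type*} (μ : YoungDiagram) (n : ℕ) (hn : ∀ j, n ≤ j → μ.rowLen j = 0) :
    ∀ p : ℕ × ℕ, p ∈ μ.cells ↔ p.1 ∈ range n ∧ p.2 ∈ range (μ.rowLen p.1) := by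
  rintro ⟨a, b⟩
  simp only [YoungDiagram.mem_cells, YoungDiagram.mem_iff_lt_rowLen, mem_range]
  have := hn a
  omega

lemma frob (μ : YoungDiagram) (n : ℕ) (hn : ∀ j, n ≤ j → μ.rowLen j = 0) :
    (Hprod μ.cells : ℚ) * DD (fun i => (LL μ n i : ℚ)) n
      = ∏ i ∈ range n, ((LL μ n i).factorial : ℚ) := by
  rw [DD_swap, Hprod, prod_finset_product μ.cells (range n) (fun i => range (μ.rowLen i))
    (cells_sigma (M := ℕ) μ n hn)]
  push_cast
  rw [← prod_mul_distrib]
  refine prod_congr rfl fun i hi => ?_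
  rw [← row_formula μ n i (mem_range.1 hi) hn]
  push_cast
  congr 1
  refine prod_congr rfl fun j hj => ?_
  rw [mem_Ioo] at hj
  have := μ.rowLen_anti i j hj.1.le
  rw [Nat.cast_sub]
  unfold LL; omega

lemma LL_inj (μ : YoungDiagram) (n : ℕ) :
    ∀ i < n, ∀ j < n, i ≠ j → (LL μ n i : ℚ) ≠ LL μ n j := by
  have hlt : ∀ a b, a < b → b < n → LL μ n b < LL μ n a := by
    intro a b hab hb
    have := μ.rowLen_anti a b hab.le
    unfold LL; omega
  intro i hi j hj hij h
  have h : LL μ n i = LL μ n j := by exact_mod_cast h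
  rcases lt_or_gt_of_ne hij with h1 | h1
  · have := hlt _ _ h1 hj; omega
  · have := hlt _ _ h1 hi; omega

lemma Hprod_ne (s : Finset (ℕ × ℕ)) : (Hprod s : ℚ) ≠ 0 := by
  have : Hprod s ≠ 0 := prod_ne_zero_iff.2 fun c _ => by unfold hook; omega
  exact_mod_cast this

lemma ratio (ν : YoungDiagram) (n : ℕ) (hn : ∀ j, n ≤ j → ν.rowLen j = 0) (c : ℕ × ℕ)
    (hc : c ∈ corners ν.cells) :
    c.1 < n ∧ ν.rowLen c.1 = c.2 + 1 ∧
    1 / (Hprod (ν.cells.erase c) : ℚ) = 1 / (Hprod ν.cells : ℚ) *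
      ((LL ν n c.1 : ℚ) * ∏ j ∈ (range n).erase c.1, (1 - 1 / ((LL ν n c.1 : ℚ) - LL ν n j))) := by
  obtain ⟨i, k⟩ := c
  simp only [corners, mem_filter, YoungDiagram.mem_cells, YoungDiagram.mem_iff_lt_rowLen] at hc
  obtain ⟨h1, h2, h3⟩ := hc
  have hin : i < n := by
    by_contra h
    have := hn i (by omega)
    omega
  have hrow : ν.rowLen i = k + 1 := by omega
  refine ⟨hin, hrow, ?_⟩
  let μ : YoungDiagram := ⟨ν.cells.erase (i, k), by
    rintro ⟨a, b⟩ ⟨a', b'⟩ hab h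
    simp only [coe_erase, Set.mem_sdiff, mem_coe, YoungDiagram.mem_cells,
      YoungDiagram.mem_iff_lt_rowLen, Set.mem_singleton_iff, Prod.mk.injEq] at h ⊢
    obtain ⟨ha, hb⟩ := Prod.mk_le_mk.1 hab
    have t1 := ν.rowLen_anti a' a ha
    refine ⟨by omega, ?_⟩
    rintro ⟨rfl, rfl⟩
    rcases Nat.lt_or_ge a' a with h' | h'
    · have := ν.rowLen_anti (a' + 1) a h'
      omega
    · have : a = a' := by omega
      subst this
      omega⟩
  have hμ : μ.cells = ν.cells.erase (i, k) := rfl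
  have hmem : ∀ a b, b < μ.rowLen a ↔ (b < ν.rowLen a ∧ ¬ (a = i ∧ b = k)) := by
    intro a b
    rw [← YoungDiagram.mem_iff_lt_rowLen, ← YoungDiagram.mem_cells, hμ, mem_erase,
      YoungDiagram.mem_cells, YoungDiagram.mem_iff_lt_rowLen, ne_eq, Prod.mk.injEq]
    tauto
  have hr1 : μ.rowLen i = k := by
    have a1 := hmem i k
    have a2 := hmem i (μ.rowLen i)
    omega
  have hr2 : ∀ a, a ≠ i → μ.rowLen a = ν.rowLen a := by
    intro a ha
    have a1 := hmem a (μ.rowLen a)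
    have a2 := hmem a (ν.rowLen a)
    omega
  have hn' : ∀ j, n ≤ j → μ.rowLen j = 0 := fun j hj => by
    rw [hr2 j (by omega)]; exact hn j hj
  have hL1 : LL ν n i = LL μ n i + 1 := by unfold LL; omega
  have hL2 : ∀ j, j ≠ i → LL μ n j = LL ν n j := fun j hj => by unfold LL; rw [hr2 j hj]
  have F1 := frob ν n hn
  have F2 := frob μ n hn'
  have hD := DD_update (fun i => (LL ν n i : ℚ)) (fun i => (LL μ n i : ℚ)) i
    (fun j hj => by simp only [hL2 j hj]) n hin
  rw [← mul_prod_erase _ _ (mem_range.2 hin), hL1, Nat.factorial_succ] at F1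
  rw [← mul_prod_erase _ _ (mem_range.2 hin)] at F2
  have e : ∏ x ∈ (range n).erase i, ((LL μ n x).factorial : ℚ) =
     ∏ x ∈ (range n).erase i, ((LL ν n x).factorial : ℚ) :=
    prod_congr rfl fun j hj => by rw [hL2 j (mem_erase.1 hj).1]
  rw [e] at F2
  have hP : ∏ j ∈ (range n).erase i, ((LL ν n i : ℚ) - LL ν n j) ≠ 0 :=
    prod_ne_zero_iff.2 fun j hj => sub_ne_zero.2
      (LL_inj ν n i hin j (mem_range.1 (mem_erase.1 hj).2) (mem_erase.1 hj).1.symm)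
  have e2 : ∏ j ∈ (range n).erase i, (1 - 1 / ((LL ν n i : ℚ) - LL ν n j)) =
      (∏ j ∈ (range n).erase i, ((LL μ n i : ℚ) - LL ν n j)) /
      ∏ j ∈ (range n).erase i, ((LL ν n i : ℚ) - LL ν n j) := by
    rw [← prod_div_distrib]
    refine prod_congr rfl fun j hj => ?_
    have : (LL ν n i : ℚ) - LL ν n j ≠ 0 := sub_ne_zero.2
      (LL_inj ν n i hin j (mem_range.1 (mem_erase.1 hj).2) (mem_erase.1 hj).1.symm)
    rw [eq_div_iff this, sub_mul, one_div_mul_cancel this, hL1]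
    push_cast; ring
  have hH1 := Hprod_ne ν.cells
  have hH2 := Hprod_ne μ.cells
  have hDμ : DD (fun i => (LL μ n i : ℚ)) n ≠ 0 := by
    intro h0
    rw [h0, mul_zero] at F2
    refine mul_ne_zero ?_ (prod_ne_zero_iff.2 fun j _ => ?_) F2.symm
    all_goals exact_mod_cast Nat.factorial_ne_zero _
  have hDν : DD (fun i => (LL ν n i : ℚ)) n ≠ 0 := by
    intro h0
    rw [h0, zero_mul] at hD
    exact mul_ne_zero hDμ hP hD
  change 1 / (Hprod (ν.cells.erase (i, k)) : ℚ) = 1 / (Hprod ν.cells : ℚ) *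
      ((LL ν n i : ℚ) * ∏ j ∈ (range n).erase i, (1 - 1 / ((LL ν n i : ℚ) - LL ν n j)))
  rw [← hμ, e2]
  have key : (Hprod ν.cells : ℚ) * DD (fun i => (LL ν n i : ℚ)) n =
      LL ν n i * ((Hprod μ.cells : ℚ) * DD (fun i => (LL μ n i : ℚ)) n) := by
    rw [F1, F2, hL1]; push_cast; ring
  rw [div_mul_eq_mul_div, one_mul, div_eq_div_iff hH2 hH1, one_mul]
  rw [mul_div_assoc', div_mul_eq_mul_div, eq_div_iff hP]
  apply mul_right_cancel₀ hDν
  linear_combination (∏ j ∈ (range n).erase i, ((LL ν n i : ℚ) - LL ν n j)) * key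
    + (LL ν n i : ℚ) * (Hprod μ.cells : ℚ) * hD

/-- For any Young diagram ν:
`∑_{λ ∈ ν∖1} cr(□_{ν/λ})/H_λ = (2/H_ν) ∑_{□∈ν} cr(□)`. -/
theorem monotone_cut_and_join_lemma (ν : YoungDiagram) :
    ∑ c ∈ corners ν.cells, (boxContent c : ℚ) / Hprod (ν.cells.erase c)
      = (2 / (Hprod ν.cells : ℚ)) * ∑ c ∈ ν.cells, (boxContent c : ℚ) := by
  obtain ⟨n, hn⟩ : ∃ n, ∀ j, n ≤ j → ν.rowLen j = 0 := by
    refine ⟨ν.colLen 0, fun j hj => ?_⟩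
    by_contra h
    have : (j, 0) ∈ ν := YoungDiagram.mem_iff_lt_rowLen.2 (by omega)
    rw [YoungDiagram.mem_iff_lt_colLen] at this
    omega
  have hcont : 2 * ∑ c ∈ ν.cells, (boxContent c : ℚ) =
      ∑ i ∈ range n, ((ν.rowLen i : ℚ) ^ 2 - ν.rowLen i * (1 + 2 * i)) := by
    rw [sum_finset_product ν.cells (range n) (fun i => range (ν.rowLen i))
      (cells_sigma (M := ℕ) ν n hn), mul_sum]
    refine sum_congr rfl fun i _ => ?_
    generalize ν.rowLen i = m
    simp only [boxContent]
    induction m with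
    | zero => simp
    | succ m ih => rw [sum_range_succ, mul_add, ih]; push_cast; ring
  have hmain := aux_main (fun i => (ν.rowLen i : ℚ)) n (fun i => (LL ν n i : ℚ)) (by
    intro i hi
    have : LL ν n i + 1 + i = ν.rowLen i + n := by unfold LL; omega
    have : (LL ν n i : ℚ) + 1 + i = ν.rowLen i + n := by exact_mod_cast this
    linear_combination this) (LL_inj ν n)
  rw [div_mul_eq_mul_div, hcont, ← hmain, div_eq_mul_one_div, mul_comm, mul_sum]
  refine sum_of_injOn Prod.fst ?_ ?_ ?_ ?_
  · rintro ⟨a, b⟩ h ⟨a', b'⟩ h' hab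
    have t := (ratio ν n hn _ h).2.1
    have t' := (ratio ν n hn _ h').2.1
    simp only at hab t t'
    subst hab
    ext <;> simp only; omega
  · intro c hc
    have := (ratio ν n hn _ hc).1
    simpa using this
  · intro i hi hni
    have hi := mem_range.1 hi
    have hr : ν.rowLen i = ν.rowLen (i + 1) := by
      by_contra h
      have := ν.rowLen_anti i (i + 1) (by omega)
      apply hni
      refine ⟨(i, ν.rowLen i - 1), ?_, rfl⟩
      simp only [corners, mem_coe, mem_filter, YoungDiagram.mem_cells,
        YoungDiagram.mem_iff_lt_rowLen]
      omega
    rcases Nat.lt_or_ge (i + 1) n with h | h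
    · have e : (LL ν n i : ℚ) = LL ν n (i + 1) + 1 := by
        have : LL ν n i = LL ν n (i + 1) + 1 := by unfold LL; omega
        exact_mod_cast this
      rw [prod_eq_zero (i := i + 1) (by simp; omega) (by rw [e]; simp)]
      simp
    · have := hn (i + 1) h
      have : LL ν n i = 0 := by unfold LL; omega
      rw [this]; simp
  · intro c hc
    obtain ⟨h1, h2, h3⟩ := ratio ν n hn c hc
    rw [div_eq_mul_one_div, h3, h2]
    simp only [boxContent]
    push_cast
    ring
end

section
/- For every partition ν of n ≥ 1, ∑_{λ∈ν∖1} (n · cr(□_{ν/λ}) − 2∑_{□∈ν}cr(□)) / H_λ = 0, where the sum runs over the partitions λ ⊆ ν with |ν| = |λ| + 1 and □_{ν/λ} denotes the box of ν not in λ. -/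
open Finset

/-- weights -/
noncomputable def ww (x : ℕ → ℚ) (s : Finset ℕ) (i : ℕ) : ℚ :=
  ∏ j ∈ s.erase i, (x i - x j - 1) / (x i - x j)

lemma ww_insert_self (x : ℕ → ℚ) (s : Finset ℕ) (a : ℕ) (ha : a ∉ s) :
    ww x (insert a s) a = ∏ j ∈ s, (x a - x j - 1) / (x a - x j) := by
  unfold ww; rw [erase_insert ha]

lemma ww_insert (x : ℕ → ℚ) (s : Finset ℕ) (a i : ℕ) (ha : a ∉ s) (hi : i ∈ s) :
    ww x (insert a s) i = ww x s i * ((x i - x a - 1) / (x i - x a)) := by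
  unfold ww
  have : a ≠ i := fun h => ha (h ▸ hi)
  rw [erase_insert_of_ne this, prod_insert (fun h => ha (mem_of_mem_erase h)), mul_comm]

lemma pf (x : ℕ → ℚ) (hx : Function.Injective x) (s : Finset ℕ) :
    ∀ y : ℚ, (∀ i ∈ s, y ≠ x i) →
    ∏ j ∈ s, (y - x j - 1) / (y - x j) = 1 - ∑ i ∈ s, ww x s i / (y - x i) := by
  induction s using Finset.induction_on with
  | empty => intro y _; simp
  | insert a s ha ih =>
    intro y hy
    have hya : y - x a ≠ 0 := sub_ne_zero.2 (hy a (mem_insert_self _ _))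
    have h1 := ih y (fun i hi => hy i (mem_insert_of_mem hi))
    have h2 := ih (x a) (fun i hi h => ha ((hx h) ▸ hi))
    rw [prod_insert ha, sum_insert ha, ww_insert_self x s a ha]
    have h3 : ∑ i ∈ s, ww x (insert a s) i / (y - x i)
        = ∑ i ∈ s, ww x s i / (y - x i)
          - (1 / (y - x a)) * (∑ i ∈ s, ww x s i / (y - x i)
            - ∑ i ∈ s, ww x s i / (x a - x i)) := by
      rw [← sum_sub_distrib, mul_sum, ← sum_sub_distrib]
      refine sum_congr rfl fun i hi => ?_
      rw [ww_insert x s a i ha hi]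
      have e1 : y - x i ≠ 0 := sub_ne_zero.2 (hy i (mem_insert_of_mem hi))
      have e2 : x a - x i ≠ 0 := sub_ne_zero.2 (fun h => ha ((hx h) ▸ hi))
      have e3 : x i - x a ≠ 0 := fun h => e2 (by linarith)
      have e4 : x i - x a = -(x a - x i) := by ring
      rw [e4]
      field_simp
      ring
    rw [h3, h1, h2]
    generalize ∑ i ∈ s, ww x s i / (y - x i) = P
    generalize ∑ i ∈ s, ww x s i / (x a - x i) = Q
    field_simp
    ring

lemma T_insert (x : ℕ → ℚ) (hx : Function.Injective x) (s : Finset ℕ) (a : ℕ) (ha : a ∉ s)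
    (g : ℚ → ℚ) :
    ∑ i ∈ insert a s, g (x i) * ww x (insert a s) i
      = ∑ i ∈ s, g (x i) * ww x s i + g (x a)
        - ∑ i ∈ s, ww x s i * ((g (x i) - g (x a)) / (x i - x a)) := by
  rw [sum_insert ha, ww_insert_self x s a ha,
    pf x hx s (x a) (fun i hi h => ha ((hx h) ▸ hi)), mul_sub, mul_sum, mul_one]
  have : ∑ i ∈ s, g (x i) * ww x (insert a s) i
      = ∑ i ∈ s, g (x i) * ww x s i - ∑ i ∈ s, ww x s i * ((g (x i) - g (x a)) / (x i - x a))
        + ∑ i ∈ s, g (x a) * (ww x s i / (x a - x i)) := by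
    rw [← sum_sub_distrib, ← sum_add_distrib]
    refine sum_congr rfl fun i hi => ?_
    rw [ww_insert x s a i ha hi]
    have e2 : x a - x i ≠ 0 := sub_ne_zero.2 (fun h => ha ((hx h) ▸ hi))
    have e4 : x i - x a = -(x a - x i) := by ring
    rw [e4]
    field_simp
    ring
  rw [this]; ring

lemma T_all (x : ℕ → ℚ) (hx : Function.Injective x) (r : ℕ → ℚ) (hr : ∀ i, x i = r i - i) (k : ℕ) :
    ∑ i ∈ range k, ww x (range k) i = k ∧
    ∑ i ∈ range k, x i * ww x (range k) i = ∑ i ∈ range k, r i - (k - 1) * k ∧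
    ∑ i ∈ range k, x i ^ 2 * ww x (range k) i =
      ∑ i ∈ range k, (r i * (r i - 1) - 2 * i * r i) -
        (k - 2) * (∑ i ∈ range k, r i - (k - 1) * k) + (k - 1) * k := by
  induction k with
  | zero => simp
  | succ k ih =>
    obtain ⟨h0, h1, h2⟩ := ih
    have hk : k ∉ range k := by simp
    have ne : ∀ i ∈ range k, x i - x k ≠ 0 :=
      fun i hi => sub_ne_zero.2 (fun h => hk ((hx h) ▸ hi))
    have t0 := T_insert x hx (range k) k hk (fun _ => 1)
    have t1 := T_insert x hx (range k) k hk (fun y => y)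
    have t2 := T_insert x hx (range k) k hk (fun y => y ^ 2)
    have u1 : ∑ i ∈ range k, ww x (range k) i * ((x i - x k) / (x i - x k)) = k := by
      rw [← h0]
      refine sum_congr rfl fun i hi => ?_
      rw [div_self (ne i hi), mul_one]
    have u2 : ∑ i ∈ range k, ww x (range k) i * ((x i ^ 2 - x k ^ 2) / (x i - x k))
        = ∑ i ∈ range k, x i * ww x (range k) i + x k * k := by
      rw [← h0, mul_sum, ← sum_add_distrib]
      refine sum_congr rfl fun i hi => ?_
      have := ne i hi
      field_simp
      ring
    simp only [one_mul, sub_self, zero_div, mul_zero, sum_const_zero, sub_zero] at t0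
    rw [u1] at t1
    rw [u2] at t2
    rw [← range_add_one] at t0 t1 t2
    rw [t0, t1, t2, h0, h1, h2]
    simp only [sum_range_succ]
    rw [hr k]
    push_cast
    refine ⟨rfl, ?_, ?_⟩ <;> ring

lemma tele1 (c : ℚ) (m : ℕ) (h : (m : ℚ) ≤ c) :
    ∏ b ∈ range m, (c - b + 1) / (c - b) = (c + 1) / (c - m + 1) := by
  induction m with
  | zero => simp; rw [div_self]; push_cast at h; linarith
  | succ m ih =>
    push_cast at h ⊢
    rw [prod_range_succ, ih (by linarith)]
    have : c - m ≠ 0 := by linarith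
    have : c - m + 1 ≠ 0 := by linarith
    have e : c - (m + 1) + 1 = c - m := by ring
    rw [e]
    field_simp

lemma tele2 (A : ℚ) (m : ℕ) (h : (m : ℚ) < A) :
    ∏ b ∈ range m, ((A - b + 1) / (A - b) * ((A - b - 1) / (A - b)))
      = (A + 1) / A * ((A - m) / (A - m + 1)) := by
  induction m with
  | zero =>
    push_cast at h
    have : A + 1 ≠ 0 := by linarith
    have : A ≠ 0 := by linarith
    simp; field_simp
  | succ m ih =>
    push_cast at h ⊢
    rw [prod_range_succ, ih (by linarith)]
    have : A - m ≠ 0 := by linarith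
    have : A - m + 1 ≠ 0 := by linarith
    have : A ≠ 0 := by have : (0:ℚ) ≤ m := by positivity
                       linarith
    have e : A - (m + 1) + 1 = A - m := by ring
    rw [e]
    field_simp
    ring

/-- product along the row of the corner -/
lemma row_prod (r col : ℕ → ℕ) (hrc : ∀ a b, b < r a ↔ a < col b) (i c : ℕ) (hc : r i = c + 1)
    (hlt : ∀ j, i < j → r j ≤ c) (t : ℕ) :
    ∏ b ∈ range c, ((c : ℚ) - b + (min (col b) (i + 1 + t) : ℕ) - i) /
        ((c : ℚ) - b + (min (col b) (i + 1 + t) : ℕ) - i - 1)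
      = ((c : ℚ) + 1 + t) * ∏ j ∈ Ico (i + 1) (i + 1 + t),
          (((r i : ℚ) - i) - ((r j : ℚ) - j) - 1) / (((r i : ℚ) - i) - ((r j : ℚ) - j)) := by
  induction t with
  | zero =>
    have := tele1 c c le_rfl
    simp only [sub_self, zero_add, div_one] at this
    simp only [add_zero, Ico_self, prod_empty, mul_one, Nat.cast_zero]
    rw [← this]
    refine prod_congr rfl fun b hb => ?_
    have hb' := mem_range.1 hb
    have : i < col b := (hrc i b).1 (by omega)
    rw [min_eq_right (by omega)]
    push_cast
    congr 1 <;> ring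
  | succ t ih =>
    set k := i + 1 + t with hk
    have hrk : r k ≤ c := hlt k (by omega)
    have hkq : (k : ℚ) = i + 1 + t := by rw [hk]; push_cast; ring
    have hrkq : (r k : ℚ) ≤ c := by exact_mod_cast hrk
    have htq : (0 : ℚ) ≤ t := by positivity
    rw [show i + 1 + (t + 1) = k + 1 by omega, prod_Ico_succ_top (by omega)]
    have step : ∏ b ∈ range c, ((c : ℚ) - b + (min (col b) (k + 1) : ℕ) - i) /
        ((c : ℚ) - b + (min (col b) (k + 1) : ℕ) - i - 1)
        = (∏ b ∈ range c, ((c : ℚ) - b + (min (col b) k : ℕ) - i) /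
        ((c : ℚ) - b + (min (col b) k : ℕ) - i - 1)) *
        ∏ b ∈ range (r k), (((c + 1 + t : ℚ) - b + 1) / ((c + 1 + t : ℚ) - b) *
          (((c + 1 + t : ℚ) - b - 1) / ((c + 1 + t : ℚ) - b))) := by
      have : range (r k) = (range c).filter (fun b => b < r k) := by
        ext b; simp; omega
      rw [this, prod_filter, ← prod_mul_distrib]
      refine prod_congr rfl fun b hb => ?_
      have hb' := mem_range.1 hb
      have hbq : (b : ℚ) + 1 ≤ c := by exact_mod_cast hb'
      split_ifs with h
      · have := (hrc k b).1 h
        rw [min_eq_right (by omega), min_eq_right (by omega)]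
        push_cast
        rw [hkq]
        have e1 : (c : ℚ) - b + (i + 1 + t) - i = c + 1 + t - b := by ring
        have e2 : (c : ℚ) - b + (i + 1 + t + 1) - i = c + 1 + t - b + 1 := by ring
        rw [e1, e2]
        have : (c : ℚ) + 1 + t - b ≠ 0 := by linarith
        have : (c : ℚ) + 1 + t - b - 1 ≠ 0 := by linarith
        have e3 : (c : ℚ) + 1 + t - b + 1 - 1 = c + 1 + t - b := by ring
        rw [e3]
        field_simp
      · have : ¬ k < col b := fun h' => h ((hrc k b).2 h')
        rw [min_eq_left (by omega), min_eq_left (by omega), mul_one]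
    rw [step, ih, tele2 _ _ (by linarith), hc, hkq]
    push_cast
    have e1 : (c : ℚ) + 1 - i - (r k - (i + 1 + t)) - 1 = c + 1 + t - r k := by ring
    have e2 : (c : ℚ) + 1 - i - (r k - (i + 1 + t)) = c + 1 + t - r k + 1 := by ring
    rw [e1, e2]
    have : (c : ℚ) + 1 + t ≠ 0 := by positivity
    field_simp
    ring

lemma hook_eq_s17 (ν : YoungDiagram) (a b : ℕ) :
    hook ν.cells (a, b) = (ν.rowLen a - b - 1) + (ν.colLen b - a - 1) + 1 := by
  unfold hook
  congr 2
  · have : (ν.cells.filter fun d => d.1 = (a, b).1 ∧ (a, b).2 < d.2)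
        = (Ico (b + 1) (ν.rowLen a)).map ⟨fun j => (a, j), Prod.mk_right_injective _⟩ := by
      ext ⟨p, q⟩
      simp only [mem_filter, YoungDiagram.mem_cells, YoungDiagram.mem_iff_lt_rowLen, mem_map, mem_Ico,
        Function.Embedding.coeFn_mk, Prod.mk.injEq]
      constructor
      · rintro ⟨h1, rfl, h2⟩; exact ⟨q, ⟨h2, h1⟩, rfl, rfl⟩
      · rintro ⟨j, ⟨h1, h2⟩, rfl, rfl⟩; exact ⟨h2, rfl, h1⟩
    rw [this, card_map, Nat.card_Ico]; omega
  · have : (ν.cells.filter fun d => d.2 = (a, b).2 ∧ (a, b).1 < d.1)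
        = (Ico (a + 1) (ν.colLen b)).map ⟨fun j => (j, b), Prod.mk_left_injective _⟩ := by
      ext ⟨p, q⟩
      simp only [mem_filter, YoungDiagram.mem_cells, YoungDiagram.mem_iff_lt_colLen, mem_map, mem_Ico,
        Function.Embedding.coeFn_mk, Prod.mk.injEq]
      constructor
      · rintro ⟨h1, rfl, h2⟩; exact ⟨p, ⟨h2, h1⟩, rfl, rfl⟩
      · rintro ⟨j, ⟨h1, h2⟩, rfl, rfl⟩; exact ⟨h2, rfl, h1⟩
    rw [this, card_map, Nat.card_Ico]; omega

lemma hook_erase (s : Finset (ℕ × ℕ)) (c d : ℕ × ℕ) (hc : c ∈ s) :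
    hook s d = hook (s.erase c) d +
      (if (c.1 = d.1 ∧ d.2 < c.2) ∨ (c.2 = d.2 ∧ d.1 < c.1) then 1 else 0) := by
  unfold hook
  rw [filter_erase, filter_erase, card_erase_eq_ite, card_erase_eq_ite]
  simp only [mem_filter, hc, true_and]
  have p1 : (c.1 = d.1 ∧ d.2 < c.2) → 0 < (s.filter fun e => e.1 = d.1 ∧ d.2 < e.2).card :=
    fun h => card_pos.2 ⟨c, by simp [hc, h]⟩
  have p2 : (c.2 = d.2 ∧ d.1 < c.1) → 0 < (s.filter fun e => e.2 = d.2 ∧ d.1 < e.1).card :=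
    fun h => card_pos.2 ⟨c, by simp [hc, h]⟩
  by_cases h1 : c.1 = d.1 ∧ d.2 < c.2
  · have h2 : ¬ (c.2 = d.2 ∧ d.1 < c.1) := by omega
    have := p1 h1
    rw [if_pos h1, if_neg h2, if_pos (Or.inl h1)]
    omega
  · by_cases h2 : c.2 = d.2 ∧ d.1 < c.1
    · have := p2 h2
      rw [if_neg h1, if_pos h2, if_pos (Or.inr h2)]
      omega
    · rw [if_neg h1, if_neg h2, if_neg (by tauto)]

lemma hook_pos (s : Finset (ℕ × ℕ)) (d : ℕ × ℕ) : 0 < hook s d := by unfold hook; omega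

/-- hook product ratio -/
lemma ratio_s17 (ν : YoungDiagram) (i c : ℕ) (hc : ν.rowLen i = c + 1) (hlt : ν.rowLen (i + 1) ≤ c) :
    (Hprod ν.cells : ℚ) / Hprod (ν.cells.erase (i, c)) =
      ((ν.rowLen i : ℚ) - i + ν.colLen 0 - 1) *
        ww (fun j => (ν.rowLen j : ℚ) - j) (range (ν.colLen 0)) i := by
  have hrc : ∀ a b, b < ν.rowLen a ↔ a < ν.colLen b := fun a b => by
    rw [← YoungDiagram.mem_iff_lt_rowLen, YoungDiagram.mem_iff_lt_colLen]
  have hlt' : ∀ j, i < j → ν.rowLen j ≤ c := fun j hj =>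
    (ν.rowLen_anti (i + 1) j hj).trans hlt
  have hmem : (i, c) ∈ ν.cells := by
    rw [YoungDiagram.mem_cells, YoungDiagram.mem_iff_lt_rowLen]; omega
  have hik : i < ν.colLen 0 := (hrc i 0).1 (by omega)
  have hcol : ν.colLen c = i + 1 := by
    have h1 := (hrc i c).1 (by omega)
    have h2 := mt (hrc (i + 1) c).2 (by omega)
    omega
  have hself : hook ν.cells (i, c) = 1 := by rw [hook_eq_s17]; omega
  -- the ratio as a product
  have e1 : (Hprod ν.cells : ℚ) / Hprod (ν.cells.erase (i, c)) =
      ∏ d ∈ ν.cells.erase (i, c), (hook ν.cells d : ℚ) / hook (ν.cells.erase (i, c)) d := by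
    unfold Hprod
    rw [← mul_prod_erase _ _ hmem, hself]
    push_cast
    rw [one_mul, prod_div_distrib]
  set A : Finset (ℕ × ℕ) := (range c).map ⟨fun j => (i, j), Prod.mk_right_injective _⟩ with hA
  set B : Finset (ℕ × ℕ) := (range i).map ⟨fun j => (j, c), Prod.mk_left_injective _⟩ with hB
  have memA : ∀ p q, (p, q) ∈ A ↔ p = i ∧ q < c := by
    intro p q
    simp only [hA, mem_map, mem_range, Function.Embedding.coeFn_mk, Prod.mk.injEq]
    constructor
    · rintro ⟨j, h1, h2⟩; obtain ⟨rfl, rfl⟩ := h2; exact ⟨rfl, h1⟩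
    · rintro ⟨rfl, h⟩; exact ⟨q, h, rfl, rfl⟩
  have memB : ∀ p q, (p, q) ∈ B ↔ p < i ∧ q = c := by
    intro p q
    simp only [hB, mem_map, mem_range, Function.Embedding.coeFn_mk, Prod.mk.injEq]
    constructor
    · rintro ⟨j, h1, h2⟩; obtain ⟨rfl, rfl⟩ := h2; exact ⟨h1, rfl⟩
    · rintro ⟨h, rfl⟩; exact ⟨p, h, rfl, rfl⟩
  have hdis : Disjoint A B := by
    rw [disjoint_left]
    rintro ⟨p, q⟩ h1 h2
    have := (memA p q).1 h1
    have := (memB p q).1 h2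
    omega
  have hsub : A ∪ B ⊆ ν.cells.erase (i, c) := by
    rintro ⟨p, q⟩ h
    rw [mem_union, memA, memB] at h
    rw [mem_erase, YoungDiagram.mem_cells, YoungDiagram.mem_iff_lt_rowLen, Ne, Prod.mk.injEq]
    rcases h with ⟨rfl, h⟩ | ⟨h, rfl⟩
    · omega
    · have := ν.rowLen_anti p i h.le
      omega
  rw [e1, ← prod_subset hsub, prod_union hdis, hA, hB, prod_map, prod_map]
  · simp only [Function.Embedding.coeFn_mk]
    have pA : ∏ b ∈ range c, (hook ν.cells (i, b) : ℚ) / hook (ν.cells.erase (i, c)) (i, b)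
        = ((ν.rowLen i : ℚ) - i + ν.colLen 0 - 1) * ∏ j ∈ Ico (i + 1) (ν.colLen 0),
          (((ν.rowLen i : ℚ) - i) - ((ν.rowLen j : ℚ) - j) - 1) /
            (((ν.rowLen i : ℚ) - i) - ((ν.rowLen j : ℚ) - j)) := by
      obtain ⟨t, ht⟩ := Nat.exists_eq_add_of_le (show i + 1 ≤ ν.colLen 0 by omega)
      have := row_prod ν.rowLen ν.colLen hrc i c hc hlt' t
      rw [← ht] at this
      have e : (ν.rowLen i : ℚ) - i + ν.colLen 0 - 1 = c + 1 + t := by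
        rw [hc, ht]; push_cast; ring
      rw [e, ← this]
      refine prod_congr rfl fun b hb => ?_
      have hb' := mem_range.1 hb
      have h1 := hook_erase ν.cells (i, c) (i, b) hmem
      rw [if_pos (Or.inl ⟨rfl, hb'⟩)] at h1
      have h2 := hook_eq_s17 ν i b
      have h3 : i < ν.colLen b := (hrc i b).1 (by omega)
      rw [min_eq_left (ν.colLen_anti 0 b (Nat.zero_le _))]
      have h4 : hook ν.cells (i, b) + b + i = c + ν.colLen b := by omega
      have h1q : (hook ν.cells (i, b) : ℚ) = hook (ν.cells.erase (i, c)) (i, b) + 1 := by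
        exact_mod_cast h1
      have h4q : (hook ν.cells (i, b) : ℚ) + b + i = c + ν.colLen b := by exact_mod_cast h4
      congr 1 <;> linarith
    have pB : ∏ a ∈ range i, (hook ν.cells (a, c) : ℚ) / hook (ν.cells.erase (i, c)) (a, c)
        = ∏ j ∈ range i, (((ν.rowLen i : ℚ) - i) - ((ν.rowLen j : ℚ) - j) - 1) /
            (((ν.rowLen i : ℚ) - i) - ((ν.rowLen j : ℚ) - j)) := by
      refine prod_congr rfl fun a ha => ?_
      have ha' := mem_range.1 ha
      have h1 := hook_erase ν.cells (i, c) (a, c) hmem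
      rw [if_pos (Or.inr ⟨rfl, ha'⟩)] at h1
      have h2 := hook_eq_s17 ν a c
      have h3 := ν.rowLen_anti a i ha'.le
      have h4 : hook ν.cells (a, c) + ν.rowLen i + a = ν.rowLen a + i + 1 := by omega
      have h1q : (hook ν.cells (a, c) : ℚ) = hook (ν.cells.erase (i, c)) (a, c) + 1 := by
        exact_mod_cast h1
      have h4q : (hook ν.cells (a, c) : ℚ) + ν.rowLen i + a = ν.rowLen a + i + 1 := by
        exact_mod_cast h4
      rw [← neg_div_neg_eq]
      congr 1 <;> linarith
    rw [pA, pB, mul_assoc]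
    congr 1
    unfold ww
    rw [mul_comm, ← prod_union]
    · refine prod_congr ?_ fun _ _ => rfl
      ext j; simp; omega
    · rw [disjoint_left]; intro j; simp; omega
  · rintro ⟨p, q⟩ h1 h2
    rw [mem_union, memA, memB] at h2
    have h := hook_erase ν.cells (i, c) (p, q) hmem
    rw [if_neg (by simp only; omega)] at h
    rw [h, add_zero, div_self]
    exact_mod_cast (hook_pos _ _).ne'

lemma sum_cells (ν : YoungDiagram) (f : ℕ × ℕ → ℚ) :
    ∑ d ∈ ν.cells, f d = ∑ i ∈ range (ν.colLen 0), ∑ j ∈ range (ν.rowLen i), f (i, j) := by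
  rw [sum_sigma']
  symm
  refine sum_bij (fun (p : (_ : ℕ) × ℕ) _ => (p.1, p.2)) ?_ ?_ ?_ ?_
  · rintro ⟨a, b⟩ h
    simp only [mem_sigma, mem_range] at h
    rw [YoungDiagram.mem_cells, YoungDiagram.mem_iff_lt_rowLen]; exact h.2
  · rintro ⟨a, b⟩ _ ⟨a', b'⟩ _ h
    simp only [Prod.mk.injEq] at h
    obtain ⟨rfl, rfl⟩ := h; rfl
  · rintro ⟨a, b⟩ h
    rw [YoungDiagram.mem_cells] at h
    refine ⟨⟨a, b⟩, ?_, rfl⟩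
    simp only [mem_sigma, mem_range]
    refine ⟨?_, YoungDiagram.mem_iff_lt_rowLen.1 h⟩
    exact YoungDiagram.mem_iff_lt_colLen.1 (ν.up_left_mem le_rfl (Nat.zero_le b) h)
  · intros; rfl

lemma sum_row (i m : ℕ) : 2 * ∑ j ∈ range m, (boxContent (i, j) : ℚ)
    = (m : ℚ) * (m - 1) - 2 * i * m := by
  induction m with
  | zero => simp
  | succ m ih =>
    rw [sum_range_succ, mul_add, ih]
    simp only [boxContent]
    push_cast
    ring

/-- Combined identity: `∑_{λ∈ν∖1} (n·cr(□_{ν/λ}) − 2∑_{□∈ν}cr(□))/H_λ = 0`. -/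
theorem sum_corner_content_combination (ν : YoungDiagram) (h : ν.cells.Nonempty) :
    ∑ c ∈ corners ν.cells,
        ((ν.cells.card : ℚ) * (boxContent c : ℚ)
          - 2 * ∑ d ∈ ν.cells, (boxContent d : ℚ)) / Hprod (ν.cells.erase c) = 0 := by
  have hrc : ∀ a b, b < ν.rowLen a ↔ a < ν.colLen b := fun a b => by
    rw [← YoungDiagram.mem_iff_lt_rowLen, YoungDiagram.mem_iff_lt_colLen]
  set k := ν.colLen 0 with hk
  set x : ℕ → ℚ := fun j => (ν.rowLen j : ℚ) - j with hxdef
  have hx : Function.Injective x := by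
    have : StrictAnti x := by
      intro a b hab
      have h1 : (ν.rowLen b : ℚ) ≤ ν.rowLen a := by exact_mod_cast ν.rowLen_anti a b hab.le
      have h2 : (a : ℚ) < b := by exact_mod_cast hab
      simp only [hxdef]; linarith
    exact this.injective
  have hn : (ν.cells.card : ℚ) = ∑ i ∈ range k, (ν.rowLen i : ℚ) := by
    have := sum_cells ν (fun _ => 1)
    simpa using this
  have hC : 2 * ∑ d ∈ ν.cells, (boxContent d : ℚ) =
      ∑ i ∈ range k, ((ν.rowLen i : ℚ) * (ν.rowLen i - 1) - 2 * i * ν.rowLen i) := by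
    rw [sum_cells ν (fun d => (boxContent d : ℚ)), mul_sum]
    exact sum_congr rfl fun i _ => sum_row i _
  obtain ⟨t0, t1, t2⟩ := T_all x hx (fun i => (ν.rowLen i : ℚ)) (fun _ => rfl) k
  rw [← hn] at t1 t2
  rw [← hC] at t2
  set n : ℚ := (ν.cells.card : ℚ)
  set C : ℚ := 2 * ∑ d ∈ ν.cells, (boxContent d : ℚ)
  have hH : (Hprod ν.cells : ℚ) ≠ 0 := by
    unfold Hprod
    exact_mod_cast (prod_pos fun d _ => hook_pos _ d).ne'
  have key : ∑ c ∈ corners ν.cells, (n * (boxContent c : ℚ) - C) / Hprod (ν.cells.erase c)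
      = ∑ i ∈ range k, (n * (x i - 1) - C) * ((x i + k - 1) * ww x (range k) i) / Hprod ν.cells := by
    have hz : ∑ i ∈ (range k).filter (fun i => ν.rowLen (i + 1) < ν.rowLen i),
          (n * (x i - 1) - C) * ((x i + k - 1) * ww x (range k) i) / Hprod ν.cells
        = ∑ i ∈ range k, (n * (x i - 1) - C) * ((x i + k - 1) * ww x (range k) i)
          / Hprod ν.cells := by
      refine sum_subset (filter_subset _ _) fun i hi hi' => ?_
      have hi2 : ¬ ν.rowLen (i + 1) < ν.rowLen i := fun h' => hi' (mem_filter.2 ⟨hi, h'⟩)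
      have hanti := ν.rowLen_anti i (i + 1) (by omega)
      have h0 : 0 < ν.rowLen i := (hrc i 0).2 (mem_range.1 hi)
      have h1 : i + 1 < k := (hrc (i + 1) 0).1 (by omega)
      have : ww x (range k) i = 0 := by
        unfold ww
        refine prod_eq_zero (i := i + 1) (by simp [h1]) ?_
        have : ν.rowLen i = ν.rowLen (i + 1) := by omega
        simp only [hxdef]
        rw [this]; push_cast; ring_nf
      rw [this]; simp
    rw [← hz]
    refine sum_bij' (fun c _ => c.1) (fun i _ => (i, ν.rowLen i - 1)) ?_ ?_ ?_ ?_ ?_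
    · rintro ⟨a, b⟩ hc
      simp only [corners, mem_filter, YoungDiagram.mem_cells, YoungDiagram.mem_iff_lt_rowLen] at hc
      simp only [mem_filter, mem_range]
      exact ⟨(hrc a 0).1 (by omega), by omega⟩
    · intro i hi
      simp only [mem_filter, mem_range] at hi
      simp only [corners, mem_filter, YoungDiagram.mem_cells, YoungDiagram.mem_iff_lt_rowLen]
      omega
    · rintro ⟨a, b⟩ hc
      simp only [corners, mem_filter, YoungDiagram.mem_cells, YoungDiagram.mem_iff_lt_rowLen] at hc
      simp only [Prod.mk.injEq, true_and]
      omega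
    · intro i _; rfl
    · rintro ⟨a, b⟩ hc
      simp only [corners, mem_filter, YoungDiagram.mem_cells, YoungDiagram.mem_iff_lt_rowLen] at hc
      have hab : ν.rowLen a = b + 1 := by omega
      have hr := ratio_s17 ν a b hab (by omega)
      have hxa : (boxContent (a, b) : ℚ) = x a - 1 := by
        simp only [boxContent, hxdef, hab]; push_cast; ring
      have hr' : (x a + k - 1) * ww x (range k) a
          = (Hprod ν.cells : ℚ) / Hprod (ν.cells.erase (a, b)) := hr.symm
      simp only
      rw [hr', hxa]
      field_simp
  rw [key, ← sum_div]
  have fin : ∑ i ∈ range k, (n * (x i - 1) - C) * ((x i + k - 1) * ww x (range k) i)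
      = n * ∑ i ∈ range k, x i ^ 2 * ww x (range k) i
        + (n * (k - 2) - C) * ∑ i ∈ range k, x i * ww x (range k) i
        - (n + C) * (k - 1) * ∑ i ∈ range k, ww x (range k) i := by
    rw [mul_sum, mul_sum, mul_sum, ← sum_add_distrib, ← sum_sub_distrib]
    refine sum_congr rfl fun i _ => ?_
    ring
  rw [fin, t0, t1, t2]
  rw [div_eq_zero_iff]
  left
  ring
end
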